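/- Divergence consistency of the auxiliary interpolants: let u=(u^x,u^y) ∈ W^{3,∞}([0,T];W^{3,∞}(Ω))² with ∇·u=0 on Ω and u=0 on ∂Ω. Then there exists a constant C depending only on Ω such that for all n and all 0≤i≤N_x−1, 0≤j≤N_y−1: (a) |[d_xũ^x+d_yũ^y]^n_{i+1/2,j+1/2}| ≤ C‖u‖_{L^∞([0,T];W^{3,∞}(Ω))}(h²+k²); (b) |d_t[d_xũ^x+d_yũ^y]^n_{i+1/2,j+1/2}| ≤ C‖u‖_{W^{2,∞}([0,T];W^{3,∞}(Ω))}(h²+k²+Δt); (c) |d_t d_t[d_xũ^x+d_yũ^y]^n_{i+1/2,j+1/2}| ≤ C‖u‖_{W^{3,∞}([0,T];W^{3,∞}(Ω))}(h²+k²+Δt). -/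

import Mathlib

open Finset MeasureTheory Real

noncomputable section

namespace RMAC

/-! ### Continuous-level notions -/

/-- Partial derivative in the first (x) variable of a function of (x, y, t). -/
def pdx (f : ℝ → ℝ → ℝ → ℝ) : ℝ → ℝ → ℝ → ℝ := fun x y t => deriv (fun s => f s y t) x

/-- Partial derivative in the second (y) variable. -/
def pdy (f : ℝ → ℝ → ℝ → ℝ) : ℝ → ℝ → ℝ → ℝ := fun x y t => deriv (fun s => f x s t) y

/-- Partial derivative in the third (t) variable. -/
def pdt (f : ℝ → ℝ → ℝ → ℝ) : ℝ → ℝ → ℝ → ℝ := fun x y t => deriv (fun s => f x y s) t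

/-- Infinitely differentiable function of (x, y, t). -/
def Smooth (f : ℝ → ℝ → ℝ → ℝ) : Prop :=
  ∀ n : ℕ, ContDiff ℝ n (fun q : ℝ × ℝ × ℝ => f q.1 q.2.1 q.2.2)

/-- `SobBound a b f Lx Ly T M` : all derivatives `∂_t^{a'} ∂_x^{b'} ∂_y^{c'} f` with `a' ≤ a`,
`b' + c' ≤ b` are bounded by `M` on `[0,Lx] × [0,Ly] × [0,T]`; this encodes
`‖f‖_{W^{a,∞}([0,T];W^{b,∞}(Ω))} ≤ M`. -/
def SobBound (a b : ℕ) (f : ℝ → ℝ → ℝ → ℝ) (Lx Ly T M : ℝ) : Prop :=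
  ∀ a' b' c' : ℕ, a' ≤ a → b' + c' ≤ b →
    ∀ x y t : ℝ, x ∈ Set.Icc 0 Lx → y ∈ Set.Icc 0 Ly → t ∈ Set.Icc 0 T →
      |(pdt^[a'] (pdx^[b'] (pdy^[c'] f))) x y t| ≤ M

/-- The time-dependent Stokes problem on `Ω = (0,Lx) × (0,Ly)`, `t ∈ (0,T]`, with
viscosity `μ`, source `(gx, gy)`, homogeneous Dirichlet boundary condition and
homogeneous initial condition. -/
def IsStokesSol (μ Lx Ly T : ℝ) (ux uy p gx gy : ℝ → ℝ → ℝ → ℝ) : Prop :=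
  (∀ x y t : ℝ, x ∈ Set.Ioo 0 Lx → y ∈ Set.Ioo 0 Ly → t ∈ Set.Ioc 0 T →
      pdt ux x y t - μ * (pdx (pdx ux) x y t + pdy (pdy ux) x y t) + pdx p x y t = gx x y t ∧
      pdt uy x y t - μ * (pdx (pdx uy) x y t + pdy (pdy uy) x y t) + pdy p x y t = gy x y t ∧
      pdx ux x y t + pdy uy x y t = 0) ∧
  (∀ x y t : ℝ, x ∈ Set.Icc 0 Lx → y ∈ Set.Icc 0 Ly → t ∈ Set.Ioc 0 T →
      (x = 0 ∨ x = Lx ∨ y = 0 ∨ y = Ly) → ux x y t = 0 ∧ uy x y t = 0) ∧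
  (∀ x y : ℝ, x ∈ Set.Icc 0 Lx → y ∈ Set.Icc 0 Ly → ux x y 0 = 0 ∧ uy x y 0 = 0)

/-- Divergence-free velocity field on `Ω` for all times in `[0,T]`. -/
def DivFree (Lx Ly T : ℝ) (ux uy : ℝ → ℝ → ℝ → ℝ) : Prop :=
  ∀ x y t : ℝ, x ∈ Set.Ioo 0 Lx → y ∈ Set.Ioo 0 Ly → t ∈ Set.Icc 0 T →
    pdx ux x y t + pdy uy x y t = 0

/-- Homogeneous velocity boundary values on `∂Ω` for all times in `[0,T]`. -/
def BoundaryZero (Lx Ly T : ℝ) (ux uy : ℝ → ℝ → ℝ → ℝ) : Prop :=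
  ∀ x y t : ℝ, x ∈ Set.Icc 0 Lx → y ∈ Set.Icc 0 Ly → t ∈ Set.Icc 0 T →
    (x = 0 ∨ x = Lx ∨ y = 0 ∨ y = Ly) → ux x y t = 0 ∧ uy x y t = 0

/-! ### The staggered (MAC) grid

Index conventions for grid functions `f : ℤ → ℤ → ℝ`:
* cell-centered functions: `f i j` is the value at `(x_{i+1/2}, y_{j+1/2})`;
* x-edge functions (like `u^x`): `f i j` is the value at `(x_i, y_{j+1/2})`,
  with `j = -1` and `j = Ny` the ghost values representing `(x_i, y_0)` and `(x_i, y_{Ny})`;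
* y-edge functions (like `u^y`): `f i j` is the value at `(x_{i+1/2}, y_j)`,
  with `i = -1` and `i = Nx` the ghost values representing `(x_0, y_j)` and `(x_{Nx}, y_j)`;
* node functions: `f i j` is the value at `(x_i, y_j)`. -/
structure Grid where
  Nx : ℕ
  Ny : ℕ
  Lx : ℝ
  Ly : ℝ
  xp : ℤ → ℝ
  yp : ℤ → ℝ
  one_le_Nx : 1 ≤ Nx
  one_le_Ny : 1 ≤ Ny
  xp_zero : xp 0 = 0
  xp_last : xp Nx = Lx
  yp_zero : yp 0 = 0
  yp_last : yp Ny = Ly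
  xp_mono : ∀ i : ℤ, 0 ≤ i → i < Nx → xp i < xp (i + 1)
  yp_mono : ∀ j : ℤ, 0 ≤ j → j < Ny → yp j < yp (j + 1)

namespace Grid

variable (G : Grid)

/-- `h_{i+1/2} = x_{i+1} - x_i`. -/
def hh (i : ℤ) : ℝ := G.xp (i + 1) - G.xp i

/-- `k_{j+1/2} = y_{j+1} - y_j`. -/
def kk (j : ℤ) : ℝ := G.yp (j + 1) - G.yp j

/-- `x_{i+1/2} = (x_i + x_{i+1})/2`. -/
def xh (i : ℤ) : ℝ := (G.xp i + G.xp (i + 1)) / 2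

/-- `y_{j+1/2} = (y_j + y_{j+1})/2`. -/
def yh (j : ℤ) : ℝ := (G.yp j + G.yp (j + 1)) / 2

/-- `h_i = (h_{i-1/2} + h_{i+1/2})/2`, with `h_0 = h_{1/2}/2`, `h_{Nx} = h_{Nx-1/2}/2`. -/
def hc (i : ℤ) : ℝ :=
  if i = 0 then G.hh 0 / 2
  else if i = (G.Nx : ℤ) then G.hh ((G.Nx : ℤ) - 1) / 2
  else (G.hh (i - 1) + G.hh i) / 2

/-- `k_j = (k_{j-1/2} + k_{j+1/2})/2`, with `k_0 = k_{1/2}/2`, `k_{Ny} = k_{Ny-1/2}/2`. -/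
def kc (j : ℤ) : ℝ :=
  if j = 0 then G.kk 0 / 2
  else if j = (G.Ny : ℤ) then G.kk ((G.Ny : ℤ) - 1) / 2
  else (G.kk (j - 1) + G.kk j) / 2

/-- `h = max_i h_{i+1/2}`. -/
def hmax : ℝ :=
  (Finset.Icc (0 : ℤ) ((G.Nx : ℤ) - 1)).sup'
    (Finset.nonempty_Icc.mpr (by have := G.one_le_Nx; omega)) G.hh

/-- `k = max_j k_{j+1/2}`. -/
def kmax : ℝ :=
  (Finset.Icc (0 : ℤ) ((G.Ny : ℤ) - 1)).sup'
    (Finset.nonempty_Icc.mpr (by have := G.one_le_Ny; omega)) G.kk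

/-- Mesh regularity: `min_{i,j} {h_{i+1/2}, k_{j+1/2}} ≥ C₀ · max_{i,j} {h_{i+1/2}, k_{j+1/2}}`. -/
def Regular (C₀ : ℝ) : Prop :=
  (∀ i : ℤ, 0 ≤ i → i < G.Nx → C₀ * G.hmax ≤ G.hh i ∧ C₀ * G.kmax ≤ G.hh i) ∧
  (∀ j : ℤ, 0 ≤ j → j < G.Ny → C₀ * G.hmax ≤ G.kk j ∧ C₀ * G.kmax ≤ G.kk j)

/-! ### Difference operators -/

/-- `d_x` of an x-edge function: value at the cell center `(x_{i+1/2}, y_{j+1/2})`. -/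
def dxEx (f : ℤ → ℤ → ℝ) (i j : ℤ) : ℝ := (f (i + 1) j - f i j) / G.hh i

/-- `D_y` of an x-edge function: value at the node `(x_i, y_j)`. -/
def DyEx (f : ℤ → ℤ → ℝ) (i j : ℤ) : ℝ := (f i j - f i (j - 1)) / G.kc j

/-- `d_y` of a y-edge function: value at the cell center `(x_{i+1/2}, y_{j+1/2})`. -/
def dyEy (f : ℤ → ℤ → ℝ) (i j : ℤ) : ℝ := (f i (j + 1) - f i j) / G.kk j

/-- `D_x` of a y-edge function: value at the node `(x_i, y_j)`. -/
def DxEy (f : ℤ → ℤ → ℝ) (i j : ℤ) : ℝ := (f i j - f (i - 1) j) / G.hc i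

/-- `D_x` of a cell-centered function: value at the x-edge point `(x_i, y_{j+1/2})`. -/
def DxC (q : ℤ → ℤ → ℝ) (i j : ℤ) : ℝ := (q i j - q (i - 1) j) / G.hc i

/-- `D_y` of a cell-centered function: value at the y-edge point `(x_{i+1/2}, y_j)`. -/
def DyC (q : ℤ → ℤ → ℝ) (i j : ℤ) : ℝ := (q i j - q i (j - 1)) / G.kc j

/-! ### Discrete inner products and norms -/

/-- `(f,g)_{l²,M}` over cell centers. -/
def ipM (f g : ℤ → ℤ → ℝ) : ℝ :=
  ∑ i ∈ Finset.Icc (0 : ℤ) ((G.Nx : ℤ) - 1), ∑ j ∈ Finset.Icc (0 : ℤ) ((G.Ny : ℤ) - 1),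
    G.hh i * G.kk j * f i j * g i j

/-- `(f,g)_{l²,T,M}` over x-edge points. -/
def ipTM (f g : ℤ → ℤ → ℝ) : ℝ :=
  ∑ i ∈ Finset.Icc (1 : ℤ) ((G.Nx : ℤ) - 1), ∑ j ∈ Finset.Icc (0 : ℤ) ((G.Ny : ℤ) - 1),
    G.hc i * G.kk j * f i j * g i j

/-- `(f,g)_{l²,M,T}` over y-edge points. -/
def ipMT (f g : ℤ → ℤ → ℝ) : ℝ :=
  ∑ i ∈ Finset.Icc (0 : ℤ) ((G.Nx : ℤ) - 1), ∑ j ∈ Finset.Icc (1 : ℤ) ((G.Ny : ℤ) - 1),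
    G.hh i * G.kc j * f i j * g i j

/-- `(f,g)_{l²,T_x}`. -/
def ipTx (f g : ℤ → ℤ → ℝ) : ℝ :=
  ∑ i ∈ Finset.Icc (0 : ℤ) (G.Nx : ℤ), ∑ j ∈ Finset.Icc (1 : ℤ) ((G.Ny : ℤ) - 1),
    G.hc i * G.kc j * f i j * g i j

/-- `(f,g)_{l²,T_y}`. -/
def ipTy (f g : ℤ → ℤ → ℝ) : ℝ :=
  ∑ i ∈ Finset.Icc (1 : ℤ) ((G.Nx : ℤ) - 1), ∑ j ∈ Finset.Icc (0 : ℤ) (G.Ny : ℤ),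
    G.hc i * G.kc j * f i j * g i j

/-- `‖v‖²_{l²} = ‖v^x‖²_{l²,T,M} + ‖v^y‖²_{l²,M,T}` for a discrete velocity. -/
def velNormSq (vx vy : ℤ → ℤ → ℝ) : ℝ := G.ipTM vx vx + G.ipMT vy vy

/-- `‖Dv‖²_{l²}` for a discrete velocity. -/
def DvelNormSq (vx vy : ℤ → ℤ → ℝ) : ℝ :=
  G.ipM (G.dxEx vx) (G.dxEx vx) + G.ipTy (G.DyEx vx) (G.DyEx vx) +
    G.ipTx (G.DxEy vy) (G.DxEy vy) + G.ipM (G.dyEy vy) (G.dyEy vy)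

/-! ### Right-hand side discretization and the RMAC scheme -/

/-- `f^{x,n}_{i,j+1/2} = (1/h_i) ∫_{x_{i-1/2}}^{x_{i+1/2}} g^x(x, y_{j+1/2}, t^n) dx`. -/
def avgFx (gx : ℝ → ℝ → ℝ → ℝ) (Δt : ℝ) : ℕ → ℤ → ℤ → ℝ := fun n i j =>
  (1 / G.hc i) * ∫ x in (G.xh (i - 1))..(G.xh i), gx x (G.yh j) ((n : ℝ) * Δt)

/-- `f^{y,n}_{i+1/2,j} = (1/k_j) ∫_{y_{j-1/2}}^{y_{j+1/2}} g^y(x_{i+1/2}, y, t^n) dy`. -/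
def avgFy (gy : ℝ → ℝ → ℝ → ℝ) (Δt : ℝ) : ℕ → ℤ → ℤ → ℝ := fun n i j =>
  (1 / G.kc j) * ∫ y in (G.yh (j - 1))..(G.yh j), gy (G.xh i) y ((n : ℝ) * Δt)

/-- The RMAC scheme for the time-dependent Stokes equations, with discrete right-hand
sides `fx`, `fy`: homogeneous discrete boundary and initial conditions, the two discrete
momentum equations and the discrete divergence-free constraint. -/
def IsRMAC (μ Δt : ℝ) (fx fy Wx Wy Z : ℕ → ℤ → ℤ → ℝ) : Prop :=
  (∀ n : ℕ, ∀ j : ℤ, Wx n 0 j = 0 ∧ Wx n (G.Nx : ℤ) j = 0) ∧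
  (∀ n : ℕ, ∀ i : ℤ, Wx n i (-1) = 0 ∧ Wx n i (G.Ny : ℤ) = 0) ∧
  (∀ n : ℕ, ∀ i : ℤ, Wy n i 0 = 0 ∧ Wy n i (G.Ny : ℤ) = 0) ∧
  (∀ n : ℕ, ∀ j : ℤ, Wy n (-1) j = 0 ∧ Wy n (G.Nx : ℤ) j = 0) ∧
  (∀ i j : ℤ, Wx 0 i j = 0 ∧ Wy 0 i j = 0) ∧
  (∀ n : ℕ, 1 ≤ n →
    ∀ i ∈ Finset.Icc (1 : ℤ) ((G.Nx : ℤ) - 1), ∀ j ∈ Finset.Icc (0 : ℤ) ((G.Ny : ℤ) - 1),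
      (Wx n i j - Wx (n - 1) i j) / Δt
        - μ * ((G.dxEx (Wx n) i j - G.dxEx (Wx n) (i - 1) j) / G.hc i)
        - μ * ((G.DyEx (Wx n) i (j + 1) - G.DyEx (Wx n) i j) / G.kk j)
        + G.DxC (Z n) i j = fx n i j) ∧
  (∀ n : ℕ, 1 ≤ n →
    ∀ i ∈ Finset.Icc (0 : ℤ) ((G.Nx : ℤ) - 1), ∀ j ∈ Finset.Icc (1 : ℤ) ((G.Ny : ℤ) - 1),
      (Wy n i j - Wy (n - 1) i j) / Δt
        - μ * ((G.DxEy (Wy n) (i + 1) j - G.DxEy (Wy n) i j) / G.hh i)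
        - μ * ((G.dyEy (Wy n) i j - G.dyEy (Wy n) i (j - 1)) / G.kc j)
        + G.DyC (Z n) i j = fy n i j) ∧
  (∀ n : ℕ, 1 ≤ n →
    ∀ i ∈ Finset.Icc (0 : ℤ) ((G.Nx : ℤ) - 1), ∀ j ∈ Finset.Icc (0 : ℤ) ((G.Ny : ℤ) - 1),
      G.dxEx (Wx n) i j + G.dyEy (Wy n) i j = 0)

/-- The compact-support condition: the discrete solution vanishes within one mesh
layer of `∂Ω`. -/
def CompactSupp (Wx Wy Z : ℕ → ℤ → ℤ → ℝ) : Prop :=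
  (∀ n : ℕ, ∀ j : ℤ,
    Wx n 0 j = 0 ∧ Wx n 1 j = 0 ∧ Wx n ((G.Nx : ℤ) - 1) j = 0 ∧ Wx n (G.Nx : ℤ) j = 0) ∧
  (∀ n : ℕ, ∀ i : ℤ,
    Wx n i (-1) = 0 ∧ Wx n i 0 = 0 ∧ Wx n i ((G.Ny : ℤ) - 1) = 0 ∧ Wx n i (G.Ny : ℤ) = 0) ∧
  (∀ n : ℕ, ∀ j : ℤ,
    Wy n (-1) j = 0 ∧ Wy n 0 j = 0 ∧ Wy n ((G.Nx : ℤ) - 1) j = 0 ∧ Wy n (G.Nx : ℤ) j = 0) ∧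
  (∀ n : ℕ, ∀ i : ℤ,
    Wy n i 0 = 0 ∧ Wy n i 1 = 0 ∧ Wy n i ((G.Ny : ℤ) - 1) = 0 ∧ Wy n i (G.Ny : ℤ) = 0) ∧
  (∀ n : ℕ, ∀ j : ℤ, Z n 0 j = 0) ∧
  (∀ n : ℕ, ∀ i : ℤ, Z n i 0 = 0)

/-! ### Auxiliary interpolants and consistency functions -/

/-- The auxiliary interpolant `ũ^{x,n}_{i,j+1/2}`, with its boundary extension. -/
def tux (ux : ℝ → ℝ → ℝ → ℝ) (Δt : ℝ) (n : ℕ) (i j : ℤ) : ℝ :=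
  if j = -1 then ux (G.xp i) (G.yp 0) ((n : ℝ) * Δt)
  else if j = (G.Ny : ℤ) then ux (G.xp i) (G.yp (G.Ny : ℤ)) ((n : ℝ) * Δt)
  else (1 / G.kk j) * (∫ y in (G.yp j)..(G.yp (j + 1)), ux (G.xp i) y ((n : ℝ) * Δt))
    - (G.kk j) ^ 2 / 6 * pdy (pdy ux) (G.xp i) (G.yh j) ((n : ℝ) * Δt)

/-- The auxiliary interpolant `ũ^{y,n}_{i+1/2,j}`, with its boundary extension. -/
def tuy (uy : ℝ → ℝ → ℝ → ℝ) (Δt : ℝ) (n : ℕ) (i j : ℤ) : ℝ :=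
  if i = -1 then uy (G.xp 0) (G.yp j) ((n : ℝ) * Δt)
  else if i = (G.Nx : ℤ) then uy (G.xp (G.Nx : ℤ)) (G.yp j) ((n : ℝ) * Δt)
  else (1 / G.hh i) * (∫ x in (G.xp i)..(G.xp (i + 1)), uy x (G.yp j) ((n : ℝ) * Δt))
    - (G.hh i) ^ 2 / 6 * pdx (pdx uy) (G.xh i) (G.yp j) ((n : ℝ) * Δt)

/-- `γ^{x,n}_{i+1/2,j+1/2} = (h_{i+1/2}²/8) ∂²u^x/∂t∂x (x_{i+1/2}, y_{j+1/2}, t^n)`. -/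
def gammax (ux : ℝ → ℝ → ℝ → ℝ) (Δt : ℝ) (n : ℕ) (i j : ℤ) : ℝ :=
  (G.hh i) ^ 2 / 8 * pdt (pdx ux) (G.xh i) (G.yh j) ((n : ℝ) * Δt)

/-- `γ^{y,n}_{i+1/2,j+1/2} = (k_{j+1/2}²/8) ∂²u^y/∂t∂y (x_{i+1/2}, y_{j+1/2}, t^n)`. -/
def gammay (uy : ℝ → ℝ → ℝ → ℝ) (Δt : ℝ) (n : ℕ) (i j : ℤ) : ℝ :=
  (G.kk j) ^ 2 / 8 * pdt (pdy uy) (G.xh i) (G.yh j) ((n : ℝ) * Δt)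

end Grid

/-! ### Averaging (interpolation) operators on a uniform grid -/

/-- `P^x_h` : x-edge function → cell-centered function. -/
def PxEx (f : ℤ → ℤ → ℝ) (i j : ℤ) : ℝ := (f i j + f (i + 1) j) / 2

/-- `P^x_h` : cell-centered function → x-edge function. -/
def PxC (q : ℤ → ℤ → ℝ) (i j : ℤ) : ℝ := (q (i - 1) j + q i j) / 2

/-- `P^x_h` : y-edge function → node function. -/
def PxEyN (f : ℤ → ℤ → ℝ) (i j : ℤ) : ℝ := (f (i - 1) j + f i j) / 2

/-- `P^x_h` : node function → y-edge function. -/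
def PxN (g : ℤ → ℤ → ℝ) (i j : ℤ) : ℝ := (g i j + g (i + 1) j) / 2

/-- `P^y_h` : y-edge function → cell-centered function. -/
def PyEy (f : ℤ → ℤ → ℝ) (i j : ℤ) : ℝ := (f i j + f i (j + 1)) / 2

/-- `P^y_h` : cell-centered function → y-edge function. -/
def PyC (q : ℤ → ℤ → ℝ) (i j : ℤ) : ℝ := (q i (j - 1) + q i j) / 2

/-- `P^y_h` : x-edge function → node function. -/
def PyEx (f : ℤ → ℤ → ℝ) (i j : ℤ) : ℝ := (f i (j - 1) + f i j) / 2

/-- `P^y_h` : node function → x-edge function. -/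
def PyN (g : ℤ → ℤ → ℝ) (i j : ℤ) : ℝ := (g i j + g i (j + 1)) / 2

namespace Grid

variable (G : Grid)

/-- The discrete nonlinear term `α^{x,n}_{i,j+1/2}` of the fully implicit RMAC scheme. -/
def alphaX (Wx Wy : ℤ → ℤ → ℝ) (i j : ℤ) : ℝ :=
  (Wx i j * G.DxC (PxEx Wx) i j
    + PxC (G.dxEx fun a b => (Wx a b) ^ 2) i j
    + PyN (fun a b => PxEyN Wy a b * G.DyEx Wx a b) i j
    + (PyEx Wx i (j + 1) * PxEyN Wy i (j + 1) - PyEx Wx i j * PxEyN Wy i j) / G.kk j) / 2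

/-- The discrete nonlinear term `α^{y,n}_{i+1/2,j}` of the fully implicit RMAC scheme. -/
def alphaY (Wx Wy : ℤ → ℤ → ℝ) (i j : ℤ) : ℝ :=
  (Wy i j * G.DyC (PyEy Wy) i j
    + PyC (G.dyEy fun a b => (Wy a b) ^ 2) i j
    + PxN (fun a b => PyEx Wx a b * G.DxEy Wy a b) i j
    + (PyEx Wx (i + 1) j * PxEyN Wy (i + 1) j - PyEx Wx i j * PxEyN Wy i j) / G.hh i) / 2

/-- The fully implicit RMAC scheme for the Navier–Stokes equations. -/
def IsRMACNS (μ Δt : ℝ) (fx fy Wx Wy Z : ℕ → ℤ → ℤ → ℝ) : Prop :=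
  (∀ n : ℕ, ∀ j : ℤ, Wx n 0 j = 0 ∧ Wx n (G.Nx : ℤ) j = 0) ∧
  (∀ n : ℕ, ∀ i : ℤ, Wx n i (-1) = 0 ∧ Wx n i (G.Ny : ℤ) = 0) ∧
  (∀ n : ℕ, ∀ i : ℤ, Wy n i 0 = 0 ∧ Wy n i (G.Ny : ℤ) = 0) ∧
  (∀ n : ℕ, ∀ j : ℤ, Wy n (-1) j = 0 ∧ Wy n (G.Nx : ℤ) j = 0) ∧
  (∀ i j : ℤ, Wx 0 i j = 0 ∧ Wy 0 i j = 0) ∧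
  (∀ n : ℕ, 1 ≤ n →
    ∀ i ∈ Finset.Icc (1 : ℤ) ((G.Nx : ℤ) - 1), ∀ j ∈ Finset.Icc (0 : ℤ) ((G.Ny : ℤ) - 1),
      (Wx n i j - Wx (n - 1) i j) / Δt
        - μ * ((G.dxEx (Wx n) i j - G.dxEx (Wx n) (i - 1) j) / G.hc i)
        - μ * ((G.DyEx (Wx n) i (j + 1) - G.DyEx (Wx n) i j) / G.kk j)
        + G.alphaX (Wx n) (Wy n) i j
        + G.DxC (Z n) i j = fx n i j) ∧
  (∀ n : ℕ, 1 ≤ n →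
    ∀ i ∈ Finset.Icc (0 : ℤ) ((G.Nx : ℤ) - 1), ∀ j ∈ Finset.Icc (1 : ℤ) ((G.Ny : ℤ) - 1),
      (Wy n i j - Wy (n - 1) i j) / Δt
        - μ * ((G.DxEy (Wy n) (i + 1) j - G.DxEy (Wy n) i j) / G.hh i)
        - μ * ((G.dyEy (Wy n) i j - G.dyEy (Wy n) i (j - 1)) / G.kc j)
        + G.alphaY (Wx n) (Wy n) i j
        + G.DyC (Z n) i j = fy n i j) ∧
  (∀ n : ℕ, 1 ≤ n →
    ∀ i ∈ Finset.Icc (0 : ℤ) ((G.Nx : ℤ) - 1), ∀ j ∈ Finset.Icc (0 : ℤ) ((G.Ny : ℤ) - 1),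
      G.dxEx (Wx n) i j + G.dyEy (Wy n) i j = 0)

/-- A uniform grid with mesh sizes `h` (in x) and `k` (in y). -/
def Uniform (h k : ℝ) : Prop :=
  (∀ i : ℤ, 0 ≤ i → i < G.Nx → G.hh i = h) ∧ (∀ j : ℤ, 0 ≤ j → j < G.Ny → G.kk j = k)

end Grid

end RMAC

open RMAC

/-! ### Partial derivatives of smooth functions -/

namespace RMAC

/-- A function of `(x, y, t)` as a function on the product space. -/
def joint (f : ℝ → ℝ → ℝ → ℝ) : ℝ × ℝ × ℝ → ℝ := fun q => f q.1 q.2.1 q.2.2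

lemma Smooth.differentiable {f : ℝ → ℝ → ℝ → ℝ} (hf : Smooth f) : Differentiable ℝ (joint f) :=
  (hf 1).differentiable (by norm_num)

lemma Smooth.continuous {f : ℝ → ℝ → ℝ → ℝ} (hf : Smooth f) : Continuous (joint f) :=
  (hf 0).continuous

lemma Smooth.hasDerivAt_x_fderiv {f : ℝ → ℝ → ℝ → ℝ} (hf : Smooth f) (x y t : ℝ) :
    HasDerivAt (fun s => f s y t) (fderiv ℝ (joint f) (x, y, t) (1, 0, 0)) x :=
  HasFDerivAt.comp_hasDerivAt (l := joint f) x (hf.differentiable (x, y, t)).hasFDerivAt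
    ((hasDerivAt_id x).prodMk ((hasDerivAt_const x y).prodMk (hasDerivAt_const x t)))

lemma Smooth.hasDerivAt_y_fderiv {f : ℝ → ℝ → ℝ → ℝ} (hf : Smooth f) (x y t : ℝ) :
    HasDerivAt (fun s => f x s t) (fderiv ℝ (joint f) (x, y, t) (0, 1, 0)) y :=
  HasFDerivAt.comp_hasDerivAt (l := joint f) y (hf.differentiable (x, y, t)).hasFDerivAt
    ((hasDerivAt_const y x).prodMk ((hasDerivAt_id y).prodMk (hasDerivAt_const y t)))

lemma Smooth.hasDerivAt_t_fderiv {f : ℝ → ℝ → ℝ → ℝ} (hf : Smooth f) (x y t : ℝ) :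
    HasDerivAt (fun s => f x y s) (fderiv ℝ (joint f) (x, y, t) (0, 0, 1)) t :=
  HasFDerivAt.comp_hasDerivAt (l := joint f) t (hf.differentiable (x, y, t)).hasFDerivAt
    ((hasDerivAt_const t x).prodMk ((hasDerivAt_const t y).prodMk (hasDerivAt_id t)))

lemma Smooth.joint_pdx {f : ℝ → ℝ → ℝ → ℝ} (hf : Smooth f) :
    joint (pdx f) = fun q => fderiv ℝ (joint f) q (1, 0, 0) :=
  funext fun q => (hf.hasDerivAt_x_fderiv q.1 q.2.1 q.2.2).deriv

lemma Smooth.joint_pdy {f : ℝ → ℝ → ℝ → ℝ} (hf : Smooth f) :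
    joint (pdy f) = fun q => fderiv ℝ (joint f) q (0, 1, 0) :=
  funext fun q => (hf.hasDerivAt_y_fderiv q.1 q.2.1 q.2.2).deriv

lemma Smooth.joint_pdt {f : ℝ → ℝ → ℝ → ℝ} (hf : Smooth f) :
    joint (pdt f) = fun q => fderiv ℝ (joint f) q (0, 0, 1) :=
  funext fun q => (hf.hasDerivAt_t_fderiv q.1 q.2.1 q.2.2).deriv

lemma Smooth.of_joint_eq_fderiv {f g : ℝ → ℝ → ℝ → ℝ} (hf : Smooth f) (v : ℝ × ℝ × ℝ)
    (hg : joint g = fun q => fderiv ℝ (joint f) q v) : Smooth g := by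
  intro n
  change ContDiff ℝ n (joint g)
  rw [hg]
  exact ((hf (n + 1)).fderiv_right (by norm_cast)).clm_apply contDiff_const

lemma Smooth.pdx {f : ℝ → ℝ → ℝ → ℝ} (hf : Smooth f) : Smooth (pdx f) :=
  hf.of_joint_eq_fderiv _ hf.joint_pdx

lemma Smooth.pdy {f : ℝ → ℝ → ℝ → ℝ} (hf : Smooth f) : Smooth (pdy f) :=
  hf.of_joint_eq_fderiv _ hf.joint_pdy

lemma Smooth.pdt {f : ℝ → ℝ → ℝ → ℝ} (hf : Smooth f) : Smooth (pdt f) :=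
  hf.of_joint_eq_fderiv _ hf.joint_pdt

lemma Smooth.pdt_iterate {f : ℝ → ℝ → ℝ → ℝ} (hf : Smooth f) (m : ℕ) :
    Smooth (RMAC.pdt^[m] f) := by
  induction m with
  | zero => exact hf
  | succ m ih => rw [Function.iterate_succ_apply']; exact ih.pdt

lemma Smooth.hasDerivAt_x {f : ℝ → ℝ → ℝ → ℝ} (hf : Smooth f) (x y t : ℝ) :
    HasDerivAt (fun s => f s y t) (RMAC.pdx f x y t) x :=
  (hf.hasDerivAt_x_fderiv x y t).differentiableAt.hasDerivAt

lemma Smooth.hasDerivAt_y {f : ℝ → ℝ → ℝ → ℝ} (hf : Smooth f) (x y t : ℝ) :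
    HasDerivAt (fun s => f x s t) (RMAC.pdy f x y t) y :=
  (hf.hasDerivAt_y_fderiv x y t).differentiableAt.hasDerivAt

lemma Smooth.hasDerivAt_t {f : ℝ → ℝ → ℝ → ℝ} (hf : Smooth f) (x y t : ℝ) :
    HasDerivAt (fun s => f x y s) (RMAC.pdt f x y t) t :=
  (hf.hasDerivAt_t_fderiv x y t).differentiableAt.hasDerivAt

lemma Smooth.fderiv_fderiv_apply_comm {f : ℝ → ℝ → ℝ → ℝ} (hf : Smooth f)
    (v w q : ℝ × ℝ × ℝ) :
    fderiv ℝ (fun p => fderiv ℝ (joint f) p v) q w =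
      fderiv ℝ (fun p => fderiv ℝ (joint f) p w) q v := by
  have hd : DifferentiableAt ℝ (fderiv ℝ (joint f)) q :=
    (((hf 2).fderiv_right (m := 1) (by norm_num)).differentiable (by norm_num)) q
  have hsymm : IsSymmSndFDerivAt ℝ (joint f) q :=
    (hf 2).contDiffAt.isSymmSndFDerivAt (by simp)
  rw [fderiv_clm_apply hd (differentiableAt_const v), fderiv_clm_apply hd (differentiableAt_const w)]
  simpa using hsymm w v

lemma Smooth.pdx_pdy_comm {f : ℝ → ℝ → ℝ → ℝ} (hf : Smooth f) :
    RMAC.pdx (RMAC.pdy f) = RMAC.pdy (RMAC.pdx f) := by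
  funext x y t
  have h := congrFun hf.pdy.joint_pdx (x, y, t)
  have h' := congrFun hf.pdx.joint_pdy (x, y, t)
  rw [hf.joint_pdy, hf.fderiv_fderiv_apply_comm] at h
  rw [hf.joint_pdx] at h'
  exact h.trans h'.symm

lemma Smooth.pdx_pdt_comm {f : ℝ → ℝ → ℝ → ℝ} (hf : Smooth f) :
    RMAC.pdx (RMAC.pdt f) = RMAC.pdt (RMAC.pdx f) := by
  funext x y t
  have h := congrFun hf.pdt.joint_pdx (x, y, t)
  have h' := congrFun hf.pdx.joint_pdt (x, y, t)
  rw [hf.joint_pdt, hf.fderiv_fderiv_apply_comm] at h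
  rw [hf.joint_pdx] at h'
  exact h.trans h'.symm

lemma Smooth.pdy_pdt_comm {f : ℝ → ℝ → ℝ → ℝ} (hf : Smooth f) :
    RMAC.pdy (RMAC.pdt f) = RMAC.pdt (RMAC.pdy f) := by
  funext x y t
  have h := congrFun hf.pdt.joint_pdy (x, y, t)
  have h' := congrFun hf.pdy.joint_pdt (x, y, t)
  rw [hf.joint_pdt, hf.fderiv_fderiv_apply_comm] at h
  rw [hf.joint_pdy] at h'
  exact h.trans h'.symm

lemma Smooth.pdx_pdt_iterate_comm {f : ℝ → ℝ → ℝ → ℝ} (hf : Smooth f) (m : ℕ) :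
    RMAC.pdx (RMAC.pdt^[m] f) = RMAC.pdt^[m] (RMAC.pdx f) := by
  induction m with
  | zero => rfl
  | succ m ih =>
    rw [Function.iterate_succ_apply', Function.iterate_succ_apply',
      (hf.pdt_iterate m).pdx_pdt_comm, ih]

lemma Smooth.pdy_pdt_iterate_comm {f : ℝ → ℝ → ℝ → ℝ} (hf : Smooth f) (m : ℕ) :
    RMAC.pdy (RMAC.pdt^[m] f) = RMAC.pdt^[m] (RMAC.pdy f) := by
  induction m with
  | zero => rfl
  | succ m ih =>
    rw [Function.iterate_succ_apply', Function.iterate_succ_apply',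
      (hf.pdt_iterate m).pdy_pdt_comm, ih]

/-! ### Mean value estimates -/

lemma abs_sub_le_of_hasDerivAt {f f' : ℝ → ℝ} {a b M : ℝ} (hab : a ≤ b)
    (hf : ∀ x, HasDerivAt f (f' x) x) (hM : ∀ x ∈ Set.Icc a b, |f' x| ≤ M) :
    |f b - f a| ≤ M * (b - a) := by
  have h := (convex_Icc a b).norm_image_sub_le_of_norm_hasDerivWithin_le
    (fun x _ => (hf x).hasDerivWithinAt) hM (Set.left_mem_Icc.2 hab) (Set.right_mem_Icc.2 hab)
  rwa [Real.norm_eq_abs, Real.norm_eq_abs, abs_of_nonneg (sub_nonneg.2 hab)] at h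

lemma abs_second_difference_le {f f' f'' : ℝ → ℝ} {a d M : ℝ} (hd : 0 ≤ d)
    (hf : ∀ x, HasDerivAt f (f' x) x) (hf' : ∀ x, HasDerivAt f' (f'' x) x)
    (hM : ∀ x ∈ Set.Icc a (a + 2 * d), |f'' x| ≤ M) :
    |(f (a + 2 * d) - f (a + d)) - (f (a + d) - f a)| ≤ M * d * d := by
  have hshift : ∀ x, HasDerivAt (fun s => f (s + d) - f s) (f' (x + d) - f' x) x := fun x =>
    ((hf (x + d)).comp_add_const x d).sub (hf x)
  have h := abs_sub_le_of_hasDerivAt (M := M * d) (a := a) (b := a + d) (by linarith) hshift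
    fun x hx => by
      have := abs_sub_le_of_hasDerivAt (a := x) (b := x + d) (by linarith) hf' fun z hz =>
        hM z ⟨by linarith [hx.1, hz.1], by linarith [hx.2, hz.2]⟩
      simpa using this
  simpa [show a + 2 * d = a + d + d by ring] using h

/-! ### The discrete divergence of the auxiliary interpolants -/

namespace Grid

variable (G : Grid)

lemma xp_mem_Icc {i : ℤ} (h0 : 0 ≤ i) (hi : i ≤ G.Nx) : G.xp i ∈ Set.Icc 0 G.Lx := by
  have hmono : MonotoneOn G.xp (Set.Icc 0 (G.Nx : ℤ)) :=
    monotoneOn_of_le_add_one Set.ordConnected_Icc fun a _ ha ha' =>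
      (G.xp_mono a ha.1 (by linarith [ha'.2])).le
  have hN : (0 : ℤ) ≤ G.Nx := h0.trans hi
  rw [← G.xp_last, ← G.xp_zero]
  exact ⟨hmono ⟨le_rfl, hN⟩ ⟨h0, hi⟩ h0, hmono ⟨h0, hi⟩ ⟨hN, le_rfl⟩ hi⟩

lemma yp_mem_Icc {j : ℤ} (h0 : 0 ≤ j) (hj : j ≤ G.Ny) : G.yp j ∈ Set.Icc 0 G.Ly := by
  have hmono : MonotoneOn G.yp (Set.Icc 0 (G.Ny : ℤ)) :=
    monotoneOn_of_le_add_one Set.ordConnected_Icc fun a _ ha ha' =>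
      (G.yp_mono a ha.1 (by linarith [ha'.2])).le
  have hN : (0 : ℤ) ≤ G.Ny := h0.trans hj
  rw [← G.yp_last, ← G.yp_zero]
  exact ⟨hmono ⟨le_rfl, hN⟩ ⟨h0, hj⟩ h0, hmono ⟨h0, hj⟩ ⟨hN, le_rfl⟩ hj⟩

/-- The `m`-th time derivative of the part of the discrete divergence of the auxiliary
interpolants contributed by their second-order corrections. -/
def divCorrection (ux uy : ℝ → ℝ → ℝ → ℝ) (i j : ℤ) (m : ℕ) (t : ℝ) : ℝ :=
  -((G.kk j) ^ 2 / 6 * (((pdt^[m] (pdy (pdy ux))) (G.xp (i + 1)) (G.yh j) t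
      - (pdt^[m] (pdy (pdy ux))) (G.xp i) (G.yh j) t) / G.hh i))
    - (G.hh i) ^ 2 / 6 * (((pdt^[m] (pdx (pdx uy))) (G.xh i) (G.yp (j + 1)) t
      - (pdt^[m] (pdx (pdx uy))) (G.xh i) (G.yp j) t) / G.kk j)

variable {G}

lemma hasDerivAt_divCorrection {ux uy : ℝ → ℝ → ℝ → ℝ} (hux : Smooth ux) (huy : Smooth uy)
    (i j : ℤ) (m : ℕ) (t : ℝ) :
    HasDerivAt (G.divCorrection ux uy i j m) (G.divCorrection ux uy i j (m + 1) t) t := by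
  have hx := hux.pdy.pdy.pdt_iterate m
  have hy := huy.pdx.pdx.pdt_iterate m
  unfold divCorrection
  simp only [Function.iterate_succ_apply']
  exact (((((hx.hasDerivAt_t _ _ t).sub (hx.hasDerivAt_t _ _ t)).div_const _).const_mul _).neg).sub
    ((((hy.hasDerivAt_t _ _ t).sub (hy.hasDerivAt_t _ _ t)).div_const _).const_mul _)

lemma abs_divCorrection_le {ux uy : ℝ → ℝ → ℝ → ℝ} (hux : Smooth ux) (huy : Smooth uy)
    {T M : ℝ} {a m : ℕ} (hm : m ≤ a) (hbx : SobBound a 3 ux G.Lx G.Ly T M)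
    (hby : SobBound a 3 uy G.Lx G.Ly T M) {i j : ℤ}
    (hi : i ∈ Finset.Icc (0 : ℤ) ((G.Nx : ℤ) - 1)) (hj : j ∈ Finset.Icc (0 : ℤ) ((G.Ny : ℤ) - 1))
    {t : ℝ} (ht : t ∈ Set.Icc 0 T) :
    |G.divCorrection ux uy i j m t| ≤ M * (G.hmax ^ 2 + G.kmax ^ 2) := by
  have hhmax : G.hh i ≤ G.hmax := Finset.le_sup' G.hh hi
  have hkmax : G.kk j ≤ G.kmax := Finset.le_sup' G.kk hj
  rw [Finset.mem_Icc] at hi hj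
  have hh : 0 < G.hh i := sub_pos.2 (G.xp_mono i hi.1 (by omega))
  have hk : 0 < G.kk j := sub_pos.2 (G.yp_mono j hj.1 (by omega))
  have hxi := G.xp_mem_Icc hi.1 (by omega)
  have hxi' := G.xp_mem_Icc (i := i + 1) (by omega) (by omega)
  have hyj := G.yp_mem_Icc hj.1 (by omega)
  have hyj' := G.yp_mem_Icc (j := j + 1) (by omega) (by omega)
  have hxh : G.xh i ∈ Set.Icc 0 G.Lx := by
    unfold xh; constructor <;> linarith [hxi.1, hxi.2, hxi'.1, hxi'.2]
  have hyh : G.yh j ∈ Set.Icc 0 G.Ly := by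
    unfold yh; constructor <;> linarith [hyj.1, hyj.2, hyj'.1, hyj'.2]
  have hM : 0 ≤ M := (abs_nonneg _).trans (hbx 0 0 0 (by omega) (by omega) _ _ _ hxi hyj ht)
  have hX : |(pdt^[m] (pdy (pdy ux))) (G.xp (i + 1)) (G.yh j) t
      - (pdt^[m] (pdy (pdy ux))) (G.xp i) (G.yh j) t| ≤ M * G.hh i :=
    abs_sub_le_of_hasDerivAt (sub_pos.1 hh).le
      (fun x => (hux.pdy.pdy.pdt_iterate m).hasDerivAt_x x (G.yh j) t) fun x hx => by
        rw [hux.pdy.pdy.pdx_pdt_iterate_comm]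
        exact hbx m 1 2 hm (by omega) x _ t ⟨hxi.1.trans hx.1, hx.2.trans hxi'.2⟩ hyh ht
  have hY : |(pdt^[m] (pdx (pdx uy))) (G.xh i) (G.yp (j + 1)) t
      - (pdt^[m] (pdx (pdx uy))) (G.xh i) (G.yp j) t| ≤ M * G.kk j :=
    abs_sub_le_of_hasDerivAt (sub_pos.1 hk).le
      (fun y => (huy.pdx.pdx.pdt_iterate m).hasDerivAt_y (G.xh i) y t) fun y hy => by
        rw [huy.pdx.pdx.pdy_pdt_iterate_comm, ← huy.pdx.pdx_pdy_comm, ← huy.pdx_pdy_comm]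
        exact hby m 2 1 hm (by omega) _ y t hxh ⟨hyj.1.trans hy.1, hy.2.trans hyj'.2⟩ ht
  rw [← div_le_iff₀ hh, ← abs_of_pos hh, ← abs_div] at hX
  rw [← div_le_iff₀ hk, ← abs_of_pos hk, ← abs_div] at hY
  have hh2 : G.hh i ^ 2 ≤ G.hmax ^ 2 := by gcongr
  have hk2 : G.kk j ^ 2 ≤ G.kmax ^ 2 := by gcongr
  have hX' := mul_le_mul (show G.kk j ^ 2 / 6 ≤ G.kmax ^ 2 by nlinarith) hX (abs_nonneg _)
    (by positivity)
  have hY' := mul_le_mul (show G.hh i ^ 2 / 6 ≤ G.hmax ^ 2 by nlinarith) hY (abs_nonneg _)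
    (by positivity)
  unfold divCorrection
  refine (abs_sub _ _).trans ?_
  rw [abs_neg, abs_mul, abs_mul, abs_of_nonneg (show 0 ≤ G.kk j ^ 2 / 6 by positivity),
    abs_of_nonneg (show 0 ≤ G.hh i ^ 2 / 6 by positivity)]
  linarith

/-- The fluxes of a divergence-free field through the edges of a cell cancel. -/
lemma integral_flux_eq_zero {Lx Ly T : ℝ} {ux uy : ℝ → ℝ → ℝ → ℝ} (hux : Smooth ux)
    (huy : Smooth uy) (hdiv : DivFree Lx Ly T ux uy) {a b c d t : ℝ} (hab : a ≤ b) (hcd : c ≤ d)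
    (ha : 0 ≤ a) (hb : b ≤ Lx) (hc : 0 ≤ c) (hd : d ≤ Ly) (ht : t ∈ Set.Icc 0 T) :
    ((∫ y in c..d, ux b y t) - ∫ y in c..d, ux a y t) +
      ((∫ x in a..b, uy x d t) - ∫ x in a..b, uy x c t) = 0 := by
  have hcont {f : ℝ → ℝ → ℝ → ℝ} (hf : Smooth f) : Continuous fun p : ℝ × ℝ => f p.1 p.2 t :=
    hf.continuous.comp (continuous_fst.prodMk (continuous_snd.prodMk continuous_const))
  have hcx {f : ℝ → ℝ → ℝ → ℝ} (hf : Smooth f) (y : ℝ) : Continuous fun x => f x y t :=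
    (hcont hf).comp (continuous_id.prodMk continuous_const)
  have hcy {f : ℝ → ℝ → ℝ → ℝ} (hf : Smooth f) (x : ℝ) : Continuous fun y => f x y t :=
    (hcont hf).comp (continuous_const.prodMk continuous_id)
  have hX : (∫ y in c..d, ux b y t) - ∫ y in c..d, ux a y t =
      ∫ y in c..d, ∫ x in a..b, pdx ux x y t := by
    rw [← intervalIntegral.integral_sub ((hcy hux b).intervalIntegrable c d)
      ((hcy hux a).intervalIntegrable c d)]
    exact intervalIntegral.integral_congr fun y _ =>
      (intervalIntegral.integral_eq_sub_of_hasDerivAt (fun x _ => hux.hasDerivAt_x x y t)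
        ((hcx hux.pdx y).intervalIntegrable a b)).symm
  have hY : (∫ x in a..b, uy x d t) - ∫ x in a..b, uy x c t =
      ∫ x in a..b, ∫ y in c..d, pdy uy x y t := by
    rw [← intervalIntegral.integral_sub ((hcx huy d).intervalIntegrable a b)
      ((hcx huy c).intervalIntegrable a b)]
    exact intervalIntegral.integral_congr fun x _ =>
      (intervalIntegral.integral_eq_sub_of_hasDerivAt (fun y _ => huy.hasDerivAt_y x y t)
        ((hcy huy.pdy x).intervalIntegrable c d)).symm
  have hswap : (∫ x in a..b, ∫ y in c..d, pdy uy x y t) =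
      ∫ y in c..d, ∫ x in a..b, pdy uy x y t :=
    intervalIntegral_intervalIntegral_swap <|
      (((hcont huy.pdy).continuousOn.integrableOn_compact
        (isCompact_uIcc.prod isCompact_uIcc)).mono_set
          (Set.prod_mono Set.uIoc_subset_uIcc Set.uIoc_subset_uIcc))
  have hneg : ∀ y ∈ Set.Ioo c d,
      (∫ x in a..b, pdx ux x y t) = -∫ x in a..b, pdy uy x y t := by
    intro y hy
    rw [← intervalIntegral.integral_neg]
    refine intervalIntegral.integral_congr_Ioo_of_le hab fun x hx => ?_
    exact eq_neg_of_add_eq_zero_left (hdiv x y t ⟨ha.trans_lt hx.1, hx.2.trans_le hb⟩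
      ⟨hc.trans_lt hy.1, hy.2.trans_le hd⟩ ht)
  rw [hX, hY, hswap, intervalIntegral.integral_congr_Ioo_of_le hcd hneg,
    intervalIntegral.integral_neg, neg_add_cancel]

lemma discrete_div_interpolant_eq {T Δt : ℝ} {ux uy : ℝ → ℝ → ℝ → ℝ} (hux : Smooth ux)
    (huy : Smooth uy) (hdiv : DivFree G.Lx G.Ly T ux uy) {i j : ℤ}
    (hi : i ∈ Finset.Icc (0 : ℤ) ((G.Nx : ℤ) - 1)) (hj : j ∈ Finset.Icc (0 : ℤ) ((G.Ny : ℤ) - 1))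
    {n : ℕ} (ht : (n : ℝ) * Δt ∈ Set.Icc 0 T) :
    G.dxEx (G.tux ux Δt n) i j + G.dyEy (G.tuy uy Δt n) i j =
      G.divCorrection ux uy i j 0 (n * Δt) := by
  rw [Finset.mem_Icc] at hi hj
  have hh : 0 < G.hh i := sub_pos.2 (G.xp_mono i hi.1 (by omega))
  have hk : 0 < G.kk j := sub_pos.2 (G.yp_mono j hj.1 (by omega))
  have hflux := integral_flux_eq_zero hux huy hdiv (sub_pos.1 hh).le (sub_pos.1 hk).le
    (G.xp_mem_Icc hi.1 (by omega)).1 (G.xp_mem_Icc (i := i + 1) (by omega) (by omega)).2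
    (G.yp_mem_Icc hj.1 (by omega)).1 (G.yp_mem_Icc (j := j + 1) (by omega) (by omega)).2 ht
  simp only [dxEx, dyEy, tux, tuy, divCorrection, if_neg (show i ≠ -1 by omega),
    if_neg (show i ≠ (G.Nx : ℤ) by omega), if_neg (show j ≠ -1 by omega),
    if_neg (show j ≠ (G.Ny : ℤ) by omega), Function.iterate_zero, id]
  rw [← sub_eq_zero, ← mul_zero (1 / (G.hh i * G.kk j)), ← hflux]
  field_simp
  ring

end Grid

end RMAC

/-- divergence consistency of the auxiliary interpolants.
For a divergence-free velocity vanishing on `∂Ω`, the discrete divergence of the auxiliary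
interpolants is `O(h²+k²)`, its first discrete time difference is `O(h²+k²+Δt)` and its
second discrete time difference is `O(h²+k²+Δt)`. -/
theorem divergence_consistency (Lx Ly : ℝ) (hLx : 0 < Lx) (hLy : 0 < Ly) :
    ∃ C : ℝ, 0 < C ∧
      ∀ T : ℝ, 0 < T → ∀ N : ℕ, 1 ≤ N → ∀ Δt : ℝ, Δt = T / N →
      ∀ G : RMAC.Grid, G.Lx = Lx → G.Ly = Ly →
      ∀ ux uy : ℝ → ℝ → ℝ → ℝ, RMAC.Smooth ux → RMAC.Smooth uy →
        RMAC.DivFree Lx Ly T ux uy → RMAC.BoundaryZero Lx Ly T ux uy →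
      ∀ M1 M2 M3 : ℝ,
        RMAC.SobBound 0 3 ux Lx Ly T M1 → RMAC.SobBound 0 3 uy Lx Ly T M1 →
        RMAC.SobBound 2 3 ux Lx Ly T M2 → RMAC.SobBound 2 3 uy Lx Ly T M2 →
        RMAC.SobBound 3 3 ux Lx Ly T M3 → RMAC.SobBound 3 3 uy Lx Ly T M3 →
      ∀ i ∈ Finset.Icc (0 : ℤ) ((G.Nx : ℤ) - 1),
      ∀ j ∈ Finset.Icc (0 : ℤ) ((G.Ny : ℤ) - 1),
      ∀ dv : ℕ → ℝ,
        (∀ n : ℕ, dv n = G.dxEx (G.tux ux Δt n) i j + G.dyEy (G.tuy uy Δt n) i j) →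
        (∀ n : ℕ, n ≤ N → |dv n| ≤ C * M1 * (G.hmax ^ 2 + G.kmax ^ 2)) ∧
        (∀ n : ℕ, 1 ≤ n → n ≤ N →
          |(dv n - dv (n - 1)) / Δt| ≤ C * M2 * (G.hmax ^ 2 + G.kmax ^ 2 + Δt)) ∧
        (∀ n : ℕ, 2 ≤ n → n ≤ N →
          |((dv n - dv (n - 1)) / Δt - (dv (n - 1) - dv (n - 2)) / Δt) / Δt| ≤
            C * M3 * (G.hmax ^ 2 + G.kmax ^ 2 + Δt)) := by
  refine ⟨1, one_pos, ?_⟩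
  rintro T hT N hN Δt hΔt G rfl rfl ux uy hux huy hdiv - M1 M2 M3 hx1 hy1 hx2 hy2 hx3 hy3
    i hi j hj dv hdv
  have hN0 : (0 : ℝ) < N := by exact_mod_cast hN
  have hΔt0 : 0 < Δt := hΔt ▸ div_pos hT hN0
  have hNΔt : (N : ℝ) * Δt = T := by rw [hΔt]; field_simp
  have htime : ∀ n : ℕ, n ≤ N → (n : ℝ) * Δt ∈ Set.Icc 0 T := fun n hn =>
    ⟨by positivity, hNΔt ▸ by gcongr⟩
  have hdv' : ∀ n : ℕ, n ≤ N → dv n = G.divCorrection ux uy i j 0 (n * Δt) := fun n hn =>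
    (hdv n).trans (Grid.discrete_div_interpolant_eq hux huy hdiv hi hj (htime n hn))
  have hderiv := Grid.hasDerivAt_divCorrection (G := G) hux huy i j
  have hM2 : 0 ≤ M2 := (abs_nonneg _).trans (hx2 0 0 0 (by omega) (by omega) _ _ _
    (G.xp_mem_Icc le_rfl (by omega)) (G.yp_mem_Icc le_rfl (by omega)) ⟨le_rfl, hT.le⟩)
  have hM3 : 0 ≤ M3 := (abs_nonneg _).trans (hx3 0 0 0 (by omega) (by omega) _ _ _
    (G.xp_mem_Icc le_rfl (by omega)) (G.yp_mem_Icc le_rfl (by omega)) ⟨le_rfl, hT.le⟩)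
  refine ⟨fun n hn => ?_, fun n hn1 hn => ?_, fun n hn2 hn => ?_⟩
  · rw [hdv' n hn, one_mul]
    exact Grid.abs_divCorrection_le hux huy le_rfl hx1 hy1 hi hj (htime n hn)
  · obtain ⟨m, rfl⟩ := Nat.exists_eq_add_of_le' hn1
    rw [Nat.add_sub_cancel, hdv' _ hn, hdv' m (by omega), abs_div, abs_of_pos hΔt0,
      div_le_iff₀ hΔt0, one_mul]
    have hm := htime m (by omega)
    have hm1 := htime _ hn
    have hstep : ((m + 1 : ℕ) : ℝ) * Δt = m * Δt + Δt := by push_cast; ring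
    rw [hstep] at hm1 ⊢
    have h := abs_sub_le_of_hasDerivAt (a := m * Δt) (b := m * Δt + Δt) (by linarith) (hderiv 0)
      fun t ht => Grid.abs_divCorrection_le hux huy (by omega) hx2 hy2 hi hj
        ⟨hm.1.trans ht.1, ht.2.trans hm1.2⟩
    refine h.trans ?_
    rw [add_sub_cancel_left]
    have hle := le_add_of_nonneg_right (a := G.hmax ^ 2 + G.kmax ^ 2) hΔt0.le
    gcongr
  · obtain ⟨m, rfl⟩ := Nat.exists_eq_add_of_le' hn2
    rw [Nat.add_sub_cancel, show m + 2 - 1 = m + 1 by omega, hdv' _ hn, hdv' (m + 1) (by omega),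
      hdv' m (by omega), ← sub_div, abs_div, abs_div, abs_of_pos hΔt0, div_le_iff₀ hΔt0,
      div_le_iff₀ hΔt0, one_mul]
    have hm := htime m (by omega)
    have hm2 := htime _ hn
    have hstep1 : ((m + 1 : ℕ) : ℝ) * Δt = m * Δt + Δt := by push_cast; ring
    have hstep2 : ((m + 2 : ℕ) : ℝ) * Δt = m * Δt + 2 * Δt := by push_cast; ring
    rw [hstep2] at hm2
    rw [hstep1, hstep2]
    have h := abs_second_difference_le (a := m * Δt) hΔt0.le (hderiv 0) (hderiv 1)
      fun t ht => Grid.abs_divCorrection_le hux huy (by omega) hx3 hy3 hi hj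
        ⟨hm.1.trans ht.1, ht.2.trans hm2.2⟩
    refine h.trans ?_
    have hle := le_add_of_nonneg_right (a := G.hmax ^ 2 + G.kmax ^ 2) hΔt0.le
    gcongr
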